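/- arXiv:1107.2493 — 2 statements merged into one kernel-verified Lean document; each statement's English description precedes it below -/
import Mathlib

section
/- Let R_{G,φ} be a uniquely ergodic Cantor minimal G-system with invariant probability measure μ, and let δ denote counting measure on ℕ. Then F(R_{G,φ}) = 𝔖(R_{G,φ}), where 𝔖(R_{G,φ}) is the set of all λ > 0 for which there exists a homeomorphism F of X × ℕ with (F × F)(R^∞_{G,φ}) = R^∞_{G,φ} and (μ × δ)(F(A)) = λ·(μ × δ)(A) for every Borel set A ⊆ X × ℕ. -/
open MeasureTheory
open scoped ENNReal

/-- The group of self-homeomorphisms of a space, under composition. -/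
instance homeomorphGroup {X : Type*} [TopologicalSpace X] : Group (X ≃ₜ X) where
  mul f g := g.trans f
  one := Homeomorph.refl X
  inv := Homeomorph.symm
  mul_assoc f g h := rfl
  one_mul f := Homeomorph.ext fun x => rfl
  mul_one f := Homeomorph.ext fun x => rfl
  inv_mul_cancel f := Homeomorph.ext fun x => f.symm_apply_apply x

section Defs

variable {X Y : Type*} [TopologicalSpace X] [TopologicalSpace Y]

/-- The orbit equivalence relation `R_{G,φ}` of an action of `G` on `X` by homeomorphisms. -/
def orbitRelOf {G : Type*} [Group G] (φ : G →* (X ≃ₜ X)) : Set (X × X) :=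
  {p | ∃ g : G, φ g p.1 = p.2}

/-- Freeness of an action by homeomorphisms. -/
def IsFreeAction {G : Type*} [Group G] (φ : G →* (X ≃ₜ X)) : Prop :=
  ∀ g : G, g ≠ 1 → ∀ x : X, φ g x ≠ x

/-- The orbit relation of a single homeomorphism, i.e. of the generated `ℤ`-action. -/
def orbitRelZ (φ : X ≃ₜ X) : Set (X × X) :=
  {p | ∃ n : ℤ, (φ ^ n) p.1 = p.2}

/-- Freeness of the `ℤ`-action generated by a homeomorphism. -/
def IsFreeZ (φ : X ≃ₜ X) : Prop :=
  ∀ n : ℤ, n ≠ 0 → ∀ x : X, (φ ^ n) x ≠ x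

/-- Minimality of an orbit equivalence relation: every class `R[x]` is dense. -/
def IsMinimalRel (R : Set (X × X)) : Prop :=
  ∀ x : X, Dense {y : X | (x, y) ∈ R}

/-- A Borel measure is `R`-invariant if it is invariant under every homeomorphism `h`
with `(x, h x) ∈ R` for all `x`. -/
def IsInvariantMeasure [MeasurableSpace X] (R : Set (X × X)) (μ : Measure X) : Prop :=
  ∀ h : X ≃ₜ X, (∀ x : X, (x, h x) ∈ R) → Measure.map h μ = μ

/-- Restriction `R|_U = R ∩ (U × U)` of a relation, as a relation on the subtype `U`. -/
def restrictRel (R : Set (X × X)) (U : Set X) : Set (↥U × ↥U) :=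
  {p | ((p.1 : X), (p.2 : X)) ∈ R}

/-- `R^n` on `X × {1,…,n}`: `((x,i),(y,j)) ∈ R^n ↔ (x,y) ∈ R`. -/
def finProdRel (R : Set (X × X)) (n : ℕ) : Set ((X × Fin n) × (X × Fin n)) :=
  {p | (p.1.1, p.2.1) ∈ R}

/-- `R^∞` on `X × ℕ`: `((x,i),(y,j)) ∈ R^∞ ↔ (x,y) ∈ R`. -/
def natProdRel (R : Set (X × X)) : Set ((X × ℕ) × (X × ℕ)) :=
  {p | (p.1.1, p.2.1) ∈ R}

/-- Topological orbit equivalence of two equivalence relations: a homeomorphism `F` of the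
underlying spaces with `(F × F)(R₁) = R₂`. -/
def OrbitEquiv (R₁ : Set (X × X)) (R₂ : Set (Y × Y)) : Prop :=
  ∃ F : X ≃ₜ Y, ∀ x y : X, (x, y) ∈ R₁ ↔ (F x, F y) ∈ R₂

/-- The fundamental group `F(R)` of a uniquely ergodic Cantor minimal system, where `μ` is
the unique invariant probability measure: the set of values `(μ × δ)(U)` (with `δ` counting
measure) over clopen sets `U ⊆ X × {1,…,n}`, `n ∈ ℕ`, such that `R^n|_U` is orbit
equivalent to `R`. -/
noncomputable def fundGroup [MeasurableSpace X] (R : Set (X × X)) (μ : Measure X) : Set ℝ :=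
  {l : ℝ | ∃ (n : ℕ) (U : Set (X × Fin n)), IsClopen U ∧
    OrbitEquiv R (restrictRel (finProdRel R n) U) ∧
    l = ((μ.prod Measure.count) U).toReal}

/-- `E_μ`: the additive subgroup of `ℝ` generated by the measures of clopen sets. -/
noncomputable def clopenValueGroup [MeasurableSpace X] (μ : Measure X) : AddSubgroup ℝ :=
  AddSubgroup.closure {r : ℝ | ∃ V : Set X, IsClopen V ∧ r = (μ V).toReal}

/-- The positive inner multiplier group `IM₊(E)` of an additive subgroup of `ℝ`. -/
def IMplus (E : AddSubgroup ℝ) : Set ℝ :=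
  {t : ℝ | 0 < t ∧ t ∈ E ∧ t⁻¹ ∈ E ∧ (fun x => t * x) '' (E : Set ℝ) = (E : Set ℝ)}

end Defs

section OrbitRel

variable {G : Type*} [Group G] {X : Type*} [TopologicalSpace X]

theorem orbitRelOf_refl (φ : G →* (X ≃ₜ X)) (x : X) : (x, x) ∈ orbitRelOf φ :=
  ⟨1, by rw [map_one]; rfl⟩

theorem orbitRelOf_symm {φ : G →* (X ≃ₜ X)} {x y : X} (h : (x, y) ∈ orbitRelOf φ) :
    (y, x) ∈ orbitRelOf φ := by
  obtain ⟨g, hg⟩ := h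
  refine ⟨g⁻¹, ?_⟩
  rw [map_inv, ← show φ g x = y from hg]
  exact (φ g).symm_apply_apply x

theorem orbitRelOf_trans {φ : G →* (X ≃ₜ X)} {x y z : X} (h₁ : (x, y) ∈ orbitRelOf φ)
    (h₂ : (y, z) ∈ orbitRelOf φ) : (x, z) ∈ orbitRelOf φ := by
  obtain ⟨g, hg⟩ := h₁
  obtain ⟨k, hk⟩ := h₂
  refine ⟨k * g, ?_⟩
  rw [map_mul, ← show φ k y = z from hk, ← show φ g x = y from hg]
  rfl

end OrbitRel

section RelHomeo

variable {G : Type*} [Group G] {X : Type*} [TopologicalSpace X]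
  {A B C D : Type*} [TopologicalSpace A] [TopologicalSpace B] [TopologicalSpace C]
  [TopologicalSpace D]

/-- Two spaces over `X` are `φ`-homeomorphic if there is a homeomorphism between them which
moves base points only within `φ`-orbits. -/
def RelHomeo (φ : G →* (X ≃ₜ X)) (p : A → X) (q : B → X) : Prop :=
  ∃ h : A ≃ₜ B, ∀ a, (p a, q (h a)) ∈ orbitRelOf φ

variable {φ : G →* (X ≃ₜ X)} {p : A → X} {q : B → X} {r : C → X} {s : D → X}

theorem RelHomeo.of_eq (h : A ≃ₜ B) (hh : ∀ a, p a = q (h a)) : RelHomeo φ p q :=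
  ⟨h, fun a => by rw [← hh a]; exact orbitRelOf_refl φ _⟩

theorem RelHomeo.symm (h : RelHomeo φ p q) : RelHomeo φ q p := by
  obtain ⟨h, hh⟩ := h
  refine ⟨h.symm, fun b => orbitRelOf_symm ?_⟩
  simpa using hh (h.symm b)

theorem RelHomeo.trans (h₁ : RelHomeo φ p q) (h₂ : RelHomeo φ q r) : RelHomeo φ p r := by
  obtain ⟨h, hh⟩ := h₁
  obtain ⟨k, hk⟩ := h₂
  exact ⟨h.trans k, fun a => orbitRelOf_trans (hh a) (hk (h a))⟩

theorem RelHomeo.sum (h₁ : RelHomeo φ p q) (h₂ : RelHomeo φ r s) :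
    RelHomeo φ (Sum.elim p r) (Sum.elim q s) := by
  obtain ⟨h, hh⟩ := h₁
  obtain ⟨k, hk⟩ := h₂
  refine ⟨h.sumCongr k, ?_⟩
  rintro (a | c)
  · exact hh a
  · exact hk c

theorem RelHomeo.prodNat (h : RelHomeo φ p q) :
    RelHomeo φ (fun a : A × ℕ => p a.1) (fun b : B × ℕ => q b.1) := by
  obtain ⟨h, hh⟩ := h
  exact ⟨h.prodCongr (Homeomorph.refl ℕ), fun a => hh a.1⟩

theorem relHomeo_prodNat_prodNat (p : A → X) :
    RelHomeo φ (fun a : (A × ℕ) × ℕ => p a.1.1) (fun a : A × ℕ => p a.1) :=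
  .of_eq ((Homeomorph.prodAssoc A ℕ ℕ).trans
    ((Homeomorph.refl A).prodCongr (Nat.pairEquiv.toHomeomorphOfDiscrete))) fun _ => rfl

theorem relHomeo_prodNat_sum_self (p : A → X) :
    RelHomeo φ (Sum.elim (fun a : A × ℕ => p a.1) (fun a : A × ℕ => p a.1))
      (fun a : A × ℕ => p a.1) := by
  refine RelHomeo.symm (.of_eq (((Homeomorph.refl A).prodCongr
    (Equiv.natSumNatEquivNat.symm.toHomeomorphOfDiscrete)).trans Homeomorph.prodSumDistrib) ?_)
  rintro ⟨a, n⟩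
  change p a = Sum.elim (fun a : A × ℕ => p a.1) (fun a : A × ℕ => p a.1)
    (Homeomorph.prodSumDistrib (a, Equiv.natSumNatEquivNat.symm n))
  rcases Equiv.natSumNatEquivNat.symm n with m | m <;> rfl

theorem relHomeo_sum_prodNat (p : A → X) (q : B → X) :
    RelHomeo φ (fun a : (A ⊕ B) × ℕ => Sum.elim p q a.1)
      (Sum.elim (fun a : A × ℕ => p a.1) (fun b : B × ℕ => q b.1)) := by
  refine .of_eq Homeomorph.sumProdDistrib ?_
  rintro ⟨a | b, n⟩ <;> rfl

/-- If `A × ℕ` contains a clopen `φ`-homeomorphic copy of `B`, then `A × ℕ` absorbs `B × ℕ`. -/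
theorem RelHomeo.absorb (e : B → A × ℕ) (he : Topology.IsEmbedding e)
    (hc : IsClopen (Set.range e)) (hR : ∀ b, (q b, p (e b).1) ∈ orbitRelOf φ) :
    RelHomeo φ (Sum.elim (fun a : A × ℕ => p a.1) (fun b : B × ℕ => q b.1))
      (fun a : A × ℕ => p a.1) := by
  have hsplit : RelHomeo φ
      (Sum.elim q (fun a : ((Set.range e)ᶜ : Set (A × ℕ)) => p a.1.1))
      (fun a : A × ℕ => p a.1) := by
    classical
    refine RelHomeo.trans (q := Sum.elim (fun a : Set.range e => p a.1.1)
      (fun a : ((Set.range e)ᶜ : Set (A × ℕ)) => p a.1.1)) ?_ ?_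
    · exact RelHomeo.sum ⟨he.toHomeomorph, hR⟩ (.of_eq (Homeomorph.refl _) fun _ => rfl)
    · refine .of_eq ((Equiv.Set.sumCompl (Set.range e)).toHomeomorphOfContinuousOpen
        (continuous_sum_dom.mpr ⟨continuous_subtype_val, continuous_subtype_val⟩)
        (isOpenMap_sum.mpr ⟨hc.isOpen.isOpenMap_subtype_val,
          hc.compl.isOpen.isOpenMap_subtype_val⟩)) ?_
      rintro (a | a) <;> rfl
  have hN := (hsplit.prodNat.trans (relHomeo_prodNat_prodNat p)).symm.trans
    (relHomeo_sum_prodNat _ _)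
  refine (hN.sum (.of_eq (Homeomorph.refl _) fun _ => rfl)).trans (.trans ?_ hN.symm)
  set qN := fun b : B × ℕ => q b.1
  set cN := fun a : ((Set.range e)ᶜ : Set (A × ℕ)) × ℕ => p a.1.1.1
  have h₁ : RelHomeo φ (Sum.elim (Sum.elim qN cN) qN) (Sum.elim (Sum.elim qN qN) cN) := by
    refine .of_eq ((Homeomorph.sumComm _ _).trans (Homeomorph.sumAssoc _ _ _).symm) ?_
    rintro ((a | a) | a) <;> rfl
  exact h₁.trans ((relHomeo_prodNat_sum_self q).sum (.of_eq (Homeomorph.refl _) fun _ => rfl))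

theorem RelHomeo.prodNat_of_embeddings (e : B → A × ℕ) (he : Topology.IsEmbedding e)
    (hec : IsClopen (Set.range e)) (heR : ∀ b, (q b, p (e b).1) ∈ orbitRelOf φ)
    (f : A → B × ℕ) (hf : Topology.IsEmbedding f)
    (hfc : IsClopen (Set.range f)) (hfR : ∀ a, (p a, q (f a).1) ∈ orbitRelOf φ) :
    RelHomeo φ (fun a : A × ℕ => p a.1) (fun b : B × ℕ => q b.1) := by
  refine (RelHomeo.absorb e he hec heR).symm.trans (.trans ?_ (RelHomeo.absorb f hf hfc hfR))
  refine .of_eq (Homeomorph.sumComm _ _) ?_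
  rintro (a | a) <;> rfl

end RelHomeo

section Minimal

variable {G : Type*} [Group G] [Countable G] {X : Type*} [TopologicalSpace X] [CompactSpace X]
  [T2Space X]

/-- For a minimal action, the whole space embeds into countably many copies of any nonempty
clopen subset of an amplification, moving points only within orbits. -/
theorem exists_embedding_prod_nat_of_minimal (φ : G →* (X ≃ₜ X))
    (hmin : IsMinimalRel (orbitRelOf φ)) {I : Type*} [TopologicalSpace I] [DiscreteTopology I]
    {U : Set (X × I)} (hU : IsClopen U) (hne : U.Nonempty) :
    ∃ e : X → U × ℕ, Topology.IsEmbedding e ∧ IsClopen (Set.range e) ∧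
      ∀ x, (x, (e x).1.1.1) ∈ orbitRelOf φ := by
  classical
  obtain ⟨⟨x₀, i⟩, hx₀⟩ := hne
  set V : Set X := {x | (x, i) ∈ U} with hV
  have hVc : IsClopen V := hU.preimage (by fun_prop : Continuous fun x : X => (x, i))
  obtain ⟨γ, hγ⟩ := exists_surjective_nat G
  have hex : ∀ x, ∃ k, φ (γ k) x ∈ V := by
    intro x
    obtain ⟨y, hy, g, hg⟩ := (hmin x).inter_open_nonempty V hVc.isOpen ⟨x₀, hx₀⟩
    obtain ⟨k, rfl⟩ := hγ g
    exact ⟨k, by rw [show φ (γ k) x = y from hg]; exact hy⟩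
  set κ : X → ℕ := fun x => Nat.find (hex x) with hκ
  have hκV : ∀ x, φ (γ (κ x)) x ∈ V := fun x => Nat.find_spec (hex x)
  have hκc : Continuous κ := by
    rw [continuous_discrete_rng]
    intro k
    have : κ ⁻¹' {k} = (φ (γ k) ⁻¹' V) ∩ ⋂ l ∈ Set.Iio k, (φ (γ l) ⁻¹' V)ᶜ := by
      ext x
      simp [hκ, Nat.find_eq_iff]
    rw [this]
    refine ((hVc.isOpen.preimage (φ (γ k)).continuous)).inter ?_
    exact (Set.finite_Iio k).isOpen_biInter fun l _ =>
      (hVc.compl.isOpen.preimage (φ (γ l)).continuous)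
  have hact : Continuous fun z : X × ℕ => φ (γ z.2) z.1 := by
    rw [continuous_prod_of_discrete_right]
    exact fun k => (φ (γ k)).continuous
  have hact' : Continuous fun z : X × ℕ => (φ (γ z.2)).symm z.1 := by
    rw [continuous_prod_of_discrete_right]
    exact fun k => (φ (γ k)).symm.continuous
  let e : X → U × ℕ := fun x => (⟨(φ (γ (κ x)) x, i), hκV x⟩, κ x)
  have hec : Continuous e :=
    ((((hact.comp (continuous_id.prodMk hκc)).prodMk continuous_const)).subtype_mk _).prodMk hκc
  have heinj : Function.Injective e := by
    intro x y hxy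
    have h₂ : κ x = κ y := congrArg Prod.snd hxy
    have h₁ : φ (γ (κ x)) x = φ (γ (κ y)) y := congrArg (fun z : U × ℕ => z.1.1.1) hxy
    rw [h₂] at h₁
    exact (φ (γ (κ y))).injective h₁
  refine ⟨e, (hec.isClosedEmbedding heinj).isEmbedding, ?_, fun x => ⟨γ (κ x), rfl⟩⟩
  refine ⟨(hec.isClosedEmbedding heinj).isClosed_range, ?_⟩
  have hrange : Set.range e = {w : U × ℕ | w.1.1.2 = i} ∩
      {w : U × ℕ | κ ((φ (γ w.2)).symm w.1.1.1) = w.2} := by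
    ext w
    constructor
    · rintro ⟨x, rfl⟩
      simp [e]
    · rintro ⟨h₁, h₂⟩
      refine ⟨(φ (γ w.2)).symm w.1.1.1, ?_⟩
      obtain ⟨⟨⟨y, j⟩, hw⟩, k⟩ := w
      simp only [Set.mem_ofPred_eq] at h₁ h₂
      subst h₁
      simp [e, h₂]
  rw [hrange]
  refine IsOpen.inter ?_ ?_
  · exact (isOpen_discrete {i}).preimage
      (by fun_prop : Continuous fun w : U × ℕ => w.1.1.2)
  · have h₁ : Continuous fun w : U × ℕ => κ ((φ (γ w.2)).symm w.1.1.1) :=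
      hκc.comp (hact'.comp
        (by fun_prop : Continuous fun w : U × ℕ => ((w.1.1.1, w.2) : X × ℕ)))
    exact (isOpen_discrete {z : ℕ × ℕ | z.1 = z.2}).preimage (h₁.prodMk continuous_snd)

omit [Countable G] in
theorem exists_embedding_of_prod_fin (φ : G →* (X ≃ₜ X)) {n : ℕ}
    {U : Set (X × Fin n)} (hU : IsClopen U) :
    ∃ e : U → X × ℕ, Topology.IsEmbedding e ∧ IsClopen (Set.range e) ∧
      ∀ u, (u.1.1, (e u).1) ∈ orbitRelOf φ := by
  have : CompactSpace U := isCompact_iff_compactSpace.mp hU.isClosed.isCompact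
  have hval : Topology.IsOpenEmbedding (Fin.val : Fin n → ℕ) :=
    .of_continuous_injective_isOpenMap continuous_of_discreteTopology Fin.val_injective
      fun _ _ => isOpen_discrete _
  have he : Topology.IsOpenEmbedding
      ((Prod.map id Fin.val : X × Fin n → X × ℕ) ∘ (Subtype.val : U → X × Fin n)) :=
    (Topology.IsOpenEmbedding.id.prodMap hval).comp hU.isOpen.isOpenEmbedding_subtypeVal
  exact ⟨_, he.isEmbedding, ⟨(isCompact_range he.continuous).isClosed, he.isOpen_range⟩,
    fun u => orbitRelOf_refl φ _⟩

/-- A nonempty clopen subset of an amplification is stably equivalent to the whole space. -/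
theorem relHomeo_prodNat_of_clopen (φ : G →* (X ≃ₜ X))
    (hmin : IsMinimalRel (orbitRelOf φ)) {n : ℕ} {U : Set (X × Fin n)} (hU : IsClopen U)
    (hne : U.Nonempty) :
    RelHomeo φ (fun u : U × ℕ => u.1.1.1) (fun x : X × ℕ => x.1) := by
  obtain ⟨e, he, hec, heR⟩ := exists_embedding_prod_nat_of_minimal φ hmin hU hne
  obtain ⟨f, hf, hfc, hfR⟩ := exists_embedding_of_prod_fin φ hU
  exact RelHomeo.prodNat_of_embeddings (p := fun u : U => u.1.1) (q := id) e he hec heR f hf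
    hfc hfR

end Minimal

section Measure

variable {G : Type*} [Group G] [Countable G] {X : Type*} [TopologicalSpace X]
  [SecondCountableTopology X] [T2Space X] [MeasurableSpace X] [BorelSpace X]

/-- Two measurable embeddings into amplifications of `X` which differ only within orbits
pull back the amplified invariant measure to the same measure. -/
theorem comap_prod_count_eq_of_mem_orbitRelOf {φ : G →* (X ≃ₜ X)} {μ : Measure X}
    [IsProbabilityMeasure μ] (hinv : IsInvariantMeasure (orbitRelOf φ) μ)
    {I J : Type*} [Countable I] [MeasurableSpace I] [MeasurableSingletonClass I]
    [Countable J] [MeasurableSpace J] [MeasurableSingletonClass J]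
    {Z : Type*} [MeasurableSpace Z] {q : Z → X × I} {t : Z → X × J}
    (hq : MeasurableEmbedding q) (ht : MeasurableEmbedding t)
    (hR : ∀ z, ((q z).1, (t z).1) ∈ orbitRelOf φ) :
    Measure.comap q (μ.prod Measure.count) = Measure.comap t (μ.prod Measure.count) := by
  let S : G × I × J → Set Z := fun k =>
    {z | φ k.1 (q z).1 = (t z).1} ∩ ({z | (q z).2 = k.2.1} ∩ {z | (t z).2 = k.2.2})
  have hSm : ∀ k, MeasurableSet (S k) := by
    intro k
    refine (measurableSet_eq_fun ((φ k.1).continuous.measurable.comp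
      (measurable_fst.comp hq.measurable)) (measurable_fst.comp ht.measurable)).inter
      (.inter ?_ ?_)
    · exact (measurable_snd.comp hq.measurable) (measurableSet_singleton k.2.1)
    · exact (measurable_snd.comp ht.measurable) (measurableSet_singleton k.2.2)
  have hSU : ⋃ k, S k = Set.univ := by
    refine Set.eq_univ_of_forall fun z => ?_
    obtain ⟨g, hg⟩ := hR z
    exact Set.mem_iUnion.mpr ⟨(g, (q z).2, (t z).2), hg, rfl, rfl⟩
  rw [Measure.ext_iff_of_iUnion_eq_univ hSU]
  rintro ⟨g, i, j⟩
  ext A hA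
  rw [Measure.restrict_apply hA, Measure.restrict_apply hA, hq.comap_apply, ht.comap_apply]
  set B := A ∩ S (g, i, j) with hB
  set P : Set X := (fun z => (q z).1) '' B with hP
  have h₁ : q '' B = P ×ˢ {i} := by
    ext ⟨x, i'⟩
    constructor
    · rintro ⟨z, hz, hzx⟩
      exact ⟨⟨z, hz, congrArg Prod.fst hzx⟩, (congrArg Prod.snd hzx).symm.trans hz.2.2.1⟩
    · rintro ⟨⟨z, hz, hzx⟩, hi⟩
      exact ⟨z, hz, Prod.ext hzx (hz.2.2.1.trans (Eq.symm hi))⟩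
  have h₂ : t '' B = (φ g '' P) ×ˢ {j} := by
    ext ⟨x, j'⟩
    constructor
    · rintro ⟨z, hz, hzx⟩
      exact ⟨⟨_, ⟨z, hz, rfl⟩, hz.2.1.trans (congrArg Prod.fst hzx)⟩,
        (congrArg Prod.snd hzx).symm.trans hz.2.2.2⟩
    · rintro ⟨⟨_, ⟨z, hz, rfl⟩, hzx⟩, hj⟩
      exact ⟨z, hz, Prod.ext (hz.2.1.symm.trans hzx) (hz.2.2.2.trans (Eq.symm hj))⟩
  have h₃ : μ (φ g '' P) = μ P := by
    have := hinv (φ g) fun x => ⟨g, rfl⟩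
    conv_lhs => rw [← this]
    rw [(φ g).measurableEmbedding.map_apply, Set.preimage_image_eq _ (φ g).injective]
  rw [h₁, h₂, Measure.prod_prod, Measure.prod_prod, Measure.count_singleton,
    Measure.count_singleton, h₃]

/-- Under unique ergodicity, an orbit equivalence of `X` onto a clopen subset of an
amplification rescales the invariant measure. -/
theorem comap_orbitEquiv_eq_smul {φ : G →* (X ≃ₜ X)} {μ : Measure X}
    [IsProbabilityMeasure μ] (hinv : IsInvariantMeasure (orbitRelOf φ) μ)
    (huniq : ∀ ν : Measure X, IsProbabilityMeasure ν → IsInvariantMeasure (orbitRelOf φ) ν →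
      ν = μ) {n : ℕ} {q : X → X × Fin n} (hq : MeasurableEmbedding q)
    (hR : ∀ x y, (x, y) ∈ orbitRelOf φ → ((q x).1, (q y).1) ∈ orbitRelOf φ) :
    Measure.comap q (μ.prod Measure.count) =
      (μ.prod Measure.count) (Set.range q) • μ := by
  set κ := Measure.comap q (μ.prod (Measure.count : Measure (Fin n))) with hκ
  have huniv : κ Set.univ = (μ.prod Measure.count) (Set.range q) := by
    rw [hκ, hq.comap_apply, Set.image_univ]
  rw [← huniv]
  by_cases h0 : κ Set.univ = 0
  · rw [h0, zero_smul, Measure.measure_univ_eq_zero.mp h0]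
  have htop : κ Set.univ ≠ ∞ := by
    rw [huniv]
    exact measure_ne_top _ _
  have hκinv : IsInvariantMeasure (orbitRelOf φ) κ := by
    intro h hh
    have key := comap_prod_count_eq_of_mem_orbitRelOf hinv hq (hq.comp h.measurableEmbedding)
      fun x => hR x (h x) (hh x)
    ext A hA
    rw [h.measurableEmbedding.map_apply]
    conv_lhs => rw [hκ, key]
    rw [(hq.comp h.measurableEmbedding).comap_apply, hκ, hq.comap_apply, Set.image_comp,
      Set.image_preimage_eq _ h.surjective]
  have hν := huniq ((κ Set.univ)⁻¹ • κ)
    ⟨by rw [Measure.smul_apply, smul_eq_mul, ENNReal.inv_mul_cancel h0 htop]⟩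
    fun h hh => by rw [Measure.map_smul, hκinv h hh]
  conv_rhs => rw [← hν]
  rw [smul_smul, ENNReal.mul_inv_cancel h0 htop, one_smul]

end Measure

section Scaling

variable {G : Type*} [Group G] [Countable G] {X : Type*} [TopologicalSpace X] [CompactSpace X]
  [SecondCountableTopology X] [T2Space X] [MeasurableSpace X] [BorelSpace X]

theorem fundGroup_value_mem_scaling [Nonempty X] {φ : G →* (X ≃ₜ X)}
    (hmin : IsMinimalRel (orbitRelOf φ)) {μ : Measure X} [IsProbabilityMeasure μ]
    (hinv : IsInvariantMeasure (orbitRelOf φ) μ)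
    (huniq : ∀ ν : Measure X, IsProbabilityMeasure ν → IsInvariantMeasure (orbitRelOf φ) ν →
      ν = μ) {n : ℕ} {U : Set (X × Fin n)} (hU : IsClopen U) (f : X ≃ₜ U)
    (hf : ∀ x y : X, (x, y) ∈ orbitRelOf φ ↔
      (f x, f y) ∈ restrictRel (finProdRel (orbitRelOf φ) n) U) :
    0 < ((μ.prod Measure.count) U).toReal ∧ ∃ F : (X × ℕ) ≃ₜ (X × ℕ),
      (∀ z w : X × ℕ, ((z, w) ∈ natProdRel (orbitRelOf φ) ↔
        (F z, F w) ∈ natProdRel (orbitRelOf φ))) ∧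
      ∀ A : Set (X × ℕ), MeasurableSet A →
        (μ.prod Measure.count) (⇑F '' A) =
          ENNReal.ofReal ((μ.prod Measure.count) U).toReal * (μ.prod Measure.count) A := by
  have hne : U.Nonempty := ⟨f (Classical.arbitrary X), (f _).2⟩
  obtain ⟨h, hh⟩ := relHomeo_prodNat_of_clopen φ hmin hU hne
  set c := (μ.prod Measure.count) U with hc
  have hctop : c ≠ ∞ := measure_ne_top _ _
  let q : X → X × Fin n := fun x => f x
  have hval : MeasurableEmbedding (Subtype.val : U → X × Fin n) :=
    .subtype_coe hU.isOpen.measurableSet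
  have hq : MeasurableEmbedding q := hval.comp f.measurableEmbedding
  have hqr : Set.range q = U := by
    rw [show q = Subtype.val ∘ f from rfl, f.surjective.range_comp, Subtype.range_val]
  have hκ := comap_orbitEquiv_eq_smul hinv huniq hq fun x y hxy => (hf x y).mp hxy
  rw [hqr, ← hc] at hκ
  let F : (X × ℕ) ≃ₜ (X × ℕ) := (f.prodCongr (Homeomorph.refl ℕ)).trans h
  have hFR : ∀ z : X × ℕ, ((f z.1).1.1, (F z).1) ∈ orbitRelOf φ := fun z => hh (f z.1, z.2)
  have hFμ : Measure.comap F (μ.prod Measure.count) = c • μ.prod Measure.count := by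
    have hcover : ⋃ k : ℕ, (Prod.snd ⁻¹' {k} : Set (X × ℕ)) = Set.univ :=
      Set.eq_univ_of_forall fun z => Set.mem_iUnion.mpr ⟨z.2, rfl⟩
    rw [Measure.ext_iff_of_iUnion_eq_univ hcover]
    intro k
    ext A hA
    rw [Measure.restrict_apply hA, Measure.restrict_apply hA]
    have hk : MeasurableEmbedding fun x : X => (x, k) := measurableEmbedding_prod_mk_right k
    set B : Set X := (fun x => (x, k)) ⁻¹' A with hB
    have hAB : A ∩ Prod.snd ⁻¹' {k} = (fun x => (x, k)) '' B := by
      ext ⟨x, j⟩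
      constructor
      · rintro ⟨h₁, h₂⟩
        obtain rfl : j = k := h₂
        exact ⟨x, h₁, rfl⟩
      · rintro ⟨x', h₁, h₂⟩
        obtain ⟨rfl, rfl⟩ := Prod.mk.inj h₂
        exact ⟨h₁, rfl⟩
    have ht : MeasurableEmbedding (F ∘ fun x : X => (x, k)) := F.measurableEmbedding.comp hk
    have key := comap_prod_count_eq_of_mem_orbitRelOf hinv hq ht fun x => hFR (x, k)
    rw [hκ] at key
    rw [hAB, F.measurableEmbedding.comap_apply, ← Set.image_comp, ← ht.comap_apply, ← key,
      Measure.smul_apply, Measure.smul_apply]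
    congr 1
    rw [← Set.prod_singleton, Measure.prod_prod, Measure.count_singleton, mul_one]
  have hscale : ∀ A : Set (X × ℕ),
      (μ.prod Measure.count) (F '' A) = c * (μ.prod Measure.count) A := by
    intro A
    rw [← F.measurableEmbedding.comap_apply, hFμ, Measure.smul_apply, smul_eq_mul]
  refine ⟨ENNReal.toReal_pos (fun h0 => ?_) hctop, F, fun z w => ?_, fun A _ => ?_⟩
  · have := hscale Set.univ
    rw [h0, zero_mul, Set.image_univ_of_surjective F.surjective, ← Set.univ_prod_univ,
      Measure.prod_prod, measure_univ, one_mul] at this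
    simp at this
  · refine (hf z.1 w.1).trans ⟨fun hzw => ?_, fun hzw => ?_⟩
    · exact orbitRelOf_trans (orbitRelOf_symm (hFR z)) (orbitRelOf_trans hzw (hFR w))
    · exact orbitRelOf_trans (hFR z) (orbitRelOf_trans hzw (orbitRelOf_symm (hFR w)))
  · rw [hscale, ENNReal.ofReal_toReal hctop]

theorem scaling_value_mem_fundGroup {φ : G →* (X ≃ₜ X)} {μ : Measure X}
    [IsProbabilityMeasure μ] (hinv : IsInvariantMeasure (orbitRelOf φ) μ) {l : ℝ} (hl : 0 < l) (F : (X × ℕ) ≃ₜ (X × ℕ))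
    (hF : ∀ z w : X × ℕ, ((z, w) ∈ natProdRel (orbitRelOf φ) ↔
      (F z, F w) ∈ natProdRel (orbitRelOf φ)))
    (hFm : ∀ A : Set (X × ℕ), MeasurableSet A →
      (μ.prod Measure.count) (⇑F '' A) = ENNReal.ofReal l * (μ.prod Measure.count) A) :
    l ∈ fundGroup (orbitRelOf φ) μ := by
  have hcont : Continuous fun x : X => F (x, 0) := by fun_prop
  obtain ⟨N, hN⟩ := (isCompact_range (continuous_snd.comp hcont)).bddAbove
  have hlt : ∀ x : X, (F (x, 0)).2 < N + 1 := fun x => Nat.lt_succ_of_le (hN ⟨x, rfl⟩)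
  let q : X → X × Fin (N + 1) := fun x => ((F (x, 0)).1, ⟨(F (x, 0)).2, hlt x⟩)
  let ι : X × Fin (N + 1) → X × ℕ := Prod.map id Fin.val
  have hι : Continuous ι := continuous_id.prodMap continuous_of_discreteTopology
  have hιinj : Function.Injective ι := Function.injective_id.prodMap Fin.val_injective
  have hιq : ∀ x, ι (q x) = F (x, 0) := fun x => rfl
  have hqc : Continuous q := by
    have h₂ : Continuous fun x : X => (⟨(F (x, 0)).2, hlt x⟩ : Fin (N + 1)) := by
      rw [continuous_discrete_rng]
      intro j
      have : (fun x : X => (⟨(F (x, 0)).2, hlt x⟩ : Fin (N + 1))) ⁻¹' {j} =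
          (fun x : X => (F (x, 0)).2) ⁻¹' {j.1} := by
        ext x
        simp [Fin.ext_iff]
      rw [this]
      exact (isOpen_discrete _).preimage (continuous_snd.comp hcont)
    exact (continuous_fst.comp hcont).prodMk h₂
  have hqinj : Function.Injective q := fun x y hxy =>
    congrArg Prod.fst (F.injective (congrArg ι hxy))
  have hqe : Topology.IsClosedEmbedding q := hqc.isClosedEmbedding hqinj
  have hrange : Set.range q = ι ⁻¹' (F '' (Set.univ ×ˢ {0})) := by
    ext u
    constructor
    · rintro ⟨x, rfl⟩
      exact ⟨(x, 0), ⟨trivial, rfl⟩, rfl⟩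
    · rintro ⟨⟨x, k⟩, ⟨-, hk⟩, hx⟩
      obtain rfl : k = 0 := hk
      exact ⟨x, hιinj hx⟩
  have hopen : IsOpen (Set.range q) := by
    rw [hrange]
    exact (F.isOpenMap _ (isOpen_univ.prod (isOpen_discrete _))).preimage hι
  have hmeas : (μ.prod Measure.count) (Set.range q) =
      (μ.prod Measure.count) (F '' (Set.univ ×ˢ {0})) := by
    have ht : MeasurableEmbedding fun x : X => F (x, 0) :=
      F.measurableEmbedding.comp (measurableEmbedding_prod_mk_right 0)
    have key := congrArg (fun ν : Measure X => ν Set.univ)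
      (comap_prod_count_eq_of_mem_orbitRelOf hinv hqe.measurableEmbedding ht
        fun x => orbitRelOf_refl φ _)
    simp only [hqe.measurableEmbedding.comap_apply, ht.comap_apply, Set.image_univ] at key
    rw [key, Set.prod_singleton, ← Set.image_comp, Set.image_univ]
    rfl
  refine ⟨N + 1, Set.range q, ⟨hqe.isClosed_range, hopen⟩,
    ⟨hqe.isEmbedding.toHomeomorph, fun x y => hF (x, 0) (y, 0)⟩, ?_⟩
  rw [hmeas, hFm _ (MeasurableSet.univ.prod (measurableSet_singleton 0)), Measure.prod_prod,
    measure_univ, Measure.count_singleton, mul_one, mul_one, ENNReal.toReal_ofReal hl.le]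

end Scaling

/-- `F(R) = 𝔖(R)`: the fundamental group equals the set of scaling constants
of `(μ × δ)` under automorphisms of `R^∞` on `X × ℕ`. -/
theorem statement7 {G : Type*} [Group G] [Countable G] {X : Type*} [TopologicalSpace X] [CompactSpace X]
    [TopologicalSpace.MetrizableSpace X] [TotallyDisconnectedSpace X] [Nonempty X]
    [MeasurableSpace X] [BorelSpace X]
    (hperf : Perfect (Set.univ : Set X))
    (φ : G →* (X ≃ₜ X)) (hfree : IsFreeAction φ) (hmin : IsMinimalRel (orbitRelOf φ))
    (μ : Measure X) [IsProbabilityMeasure μ] (hinv : IsInvariantMeasure (orbitRelOf φ) μ)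
    (huniq : ∀ ν : Measure X, IsProbabilityMeasure ν → IsInvariantMeasure (orbitRelOf φ) ν → ν = μ) :
    fundGroup (orbitRelOf φ) μ =
      {l : ℝ | 0 < l ∧ ∃ F : (X × ℕ) ≃ₜ (X × ℕ),
        (∀ z w : X × ℕ, ((z, w) ∈ natProdRel (orbitRelOf φ) ↔
          (F z, F w) ∈ natProdRel (orbitRelOf φ))) ∧
        ∀ A : Set (X × ℕ), MeasurableSet A →
          (μ.prod Measure.count) (⇑F '' A) = ENNReal.ofReal l * (μ.prod Measure.count) A} := by
  ext l
  constructor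
  · rintro ⟨n, U, hU, ⟨f, hf⟩, rfl⟩
    exact fundGroup_value_mem_scaling hmin hinv huniq hU f hf
  · rintro ⟨hl, F, hF, hFm⟩
    exact scaling_value_mem_fundGroup hinv hl F hF hFm
end

section
/- Let R_{G,φ} be a uniquely ergodic Cantor minimal G-system with invariant probability measure μ, and let E_μ be the additive subgroup of ℝ generated by {μ(V) : V a clopen subset of X}. Then F(R_{G,φ}) ⊆ IM₊(E_μ); that is, every λ ∈ F(R_{G,φ}) satisfies λ ∈ E_μ, λ⁻¹ ∈ E_μ, and λ·E_μ = E_μ. -/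
open MeasureTheory
open scoped ENNReal

section Helpers

variable {G : Type*} [Group G] {X : Type*} [TopologicalSpace X]

lemma action_inv_apply (φ : G →* (X ≃ₜ X)) (g : G) (x : X) : φ g⁻¹ (φ g x) = x := by
  have h : φ g⁻¹ * φ g = 1 := by rw [← map_mul, inv_mul_cancel, map_one]
  exact congrArg (fun e : X ≃ₜ X => e x) h

lemma action_map_eq [MeasurableSpace X] (φ : G →* (X ≃ₜ X)) {μ : Measure X}
    (hinv : IsInvariantMeasure (orbitRelOf φ) μ) (g : G) : Measure.map (φ g) μ = μ :=
  hinv (φ g) fun _ => ⟨g, rfl⟩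

lemma measure_action_image [MeasurableSpace X] [BorelSpace X] (φ : G →* (X ≃ₜ X)) {μ : Measure X}
    (hinv : IsInvariantMeasure (orbitRelOf φ) μ) (g : G) (S : Set X) : μ (φ g '' S) = μ S := by
  conv_lhs => rw [← action_map_eq φ hinv g]
  rw [(φ g).measurableEmbedding.map_apply, Set.preimage_image_eq _ (φ g).injective]

lemma IsMinimalRel.exists_mem (φ : G →* (X ≃ₜ X)) (hmin : IsMinimalRel (orbitRelOf φ))
    {W : Set X} (hW : IsOpen W) (hne : W.Nonempty) (x : X) : ∃ g, φ g x ∈ W := by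
  obtain ⟨y, ⟨g, hg⟩, hyW⟩ := (hmin x).exists_mem_open hW hne
  exact ⟨g, by simpa [hg] using hyW⟩

lemma IsMinimalRel.measure_ne_zero [Countable G] [MeasurableSpace X] [BorelSpace X]
    (φ : G →* (X ≃ₜ X)) (hmin : IsMinimalRel (orbitRelOf φ)) {μ : Measure X} [NeZero μ]
    (hinv : IsInvariantMeasure (orbitRelOf φ) μ) {W : Set X} (hW : IsOpen W)
    (hne : W.Nonempty) : μ W ≠ 0 := by
  intro h0
  have hcover : (⋃ g, φ g ⁻¹' W) = Set.univ :=
    Set.eq_univ_of_forall fun x => Set.mem_iUnion.2 (hmin.exists_mem φ hW hne x)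
  have hzero : μ (⋃ g, φ g ⁻¹' W) = 0 := measure_iUnion_null fun g => by
    rw [← (φ g).measurableEmbedding.map_apply, action_map_eq φ hinv g, h0]
  rw [hcover] at hzero
  exact NeZero.ne μ (Measure.measure_univ_eq_zero.1 hzero)

lemma prod_count_prod_singleton {Ω : Type*} [MeasurableSpace Ω] (μ : Measure Ω) [SFinite μ]
    {n : ℕ} (S : Set Ω) (i : Fin n) : (μ.prod Measure.count) (S ×ˢ {i}) = μ S := by
  rw [Measure.prod_prod, Measure.count_singleton, mul_one]

lemma prod_count_toReal_mem [MeasurableSpace X] [BorelSpace X] [SecondCountableTopology X]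
    (μ : Measure X) [IsFiniteMeasure μ] {n : ℕ} {C : Set (X × Fin n)} (hC : IsClopen C) :
    ((μ.prod Measure.count) C).toReal ∈ clopenValueGroup μ := by
  rw [Measure.prod_apply_symm hC.isOpen.measurableSet, lintegral_count, tsum_fintype,
    ENNReal.toReal_sum fun i _ => measure_ne_top _ _]
  refine AddSubgroup.sum_mem _ fun i _ => AddSubgroup.subset_closure ⟨_, ?_, rfl⟩
  exact hC.preimage (by fun_prop)

/-- Pulling back `μ × δ` along an embedding which respects the orbit relations yields an
invariant measure. -/
lemma isInvariantMeasure_comap [Countable G] [T2Space X] [MeasurableSpace X] [BorelSpace X]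
    (φ : G →* (X ≃ₜ X)) {μ : Measure X} [SFinite μ]
    (hinv : IsInvariantMeasure (orbitRelOf φ) μ) {n : ℕ} {F : X → X × Fin n}
    (hFc : Continuous F) (hF : MeasurableEmbedding F)
    (hrel : ∀ x y, (x, y) ∈ orbitRelOf φ → (F x, F y) ∈ finProdRel (orbitRelOf φ) n) :
    IsInvariantMeasure (orbitRelOf φ) ((μ.prod Measure.count).comap F) := by
  intro h hh
  let P : G × Fin n × Fin n → Set X := fun c =>
    {x | (F x).2 = c.2.1 ∧ (F (h x)).2 = c.2.2 ∧ φ c.1 (F x).1 = (F (h x)).1}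
  have hPm : ∀ c, MeasurableSet (P c) := fun c => by
    refine IsClosed.measurableSet ?_
    exact (isClosed_eq (by fun_prop) (by fun_prop)).inter
      ((isClosed_eq (by fun_prop) (by fun_prop)).inter (isClosed_eq (by fun_prop) (by fun_prop)))
  have hcover : (⋃ c, h '' P c) = Set.univ := by
    refine Set.eq_univ_of_forall fun y => ?_
    obtain ⟨x, rfl⟩ := h.surjective y
    obtain ⟨g, hg⟩ := hrel _ _ (hh x)
    exact Set.mem_iUnion.2 ⟨(g, (F x).2, (F (h x)).2), x, ⟨rfl, rfl, hg⟩, rfl⟩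
  refine (Measure.ext_iff_of_iUnion_eq_univ hcover).2 fun c => Measure.ext fun B hB => ?_
  rw [Measure.restrict_apply hB, Measure.restrict_apply hB, h.measurableEmbedding.map_apply,
    hF.comap_apply, hF.comap_apply, Set.preimage_inter, Set.preimage_image_eq _ h.injective]
  set C := h ⁻¹' B ∩ P c with hC
  have hBC : B ∩ h '' P c = h '' C := (Set.image_preimage_inter h (P c) B).symm
  have e1 : F '' C = ((fun x => (F x).1) '' C) ×ˢ {c.2.1} := by
    ext ⟨a, i⟩
    constructor
    · rintro ⟨x, hx, hxa⟩
      exact ⟨⟨x, hx, by simp [hxa]⟩, by simpa [hxa] using hx.2.1⟩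
    · rintro ⟨⟨x, hx, hxa⟩, hi⟩
      exact ⟨x, hx, Prod.ext hxa (hx.2.1.trans hi.symm)⟩
  have e2 : F '' (h '' C) = (φ c.1 '' ((fun x => (F x).1) '' C)) ×ˢ {c.2.2} := by
    ext ⟨a, i⟩
    constructor
    · rintro ⟨_, ⟨x, hx, rfl⟩, hxa⟩
      exact ⟨⟨_, ⟨x, hx, rfl⟩, by simpa [hxa] using hx.2.2.2⟩, by simpa [hxa] using hx.2.2.1⟩
    · rintro ⟨⟨_, ⟨x, hx, rfl⟩, hxa⟩, hi⟩
      exact ⟨_, ⟨x, hx, rfl⟩, Prod.ext (hx.2.2.2.symm.trans hxa) (hx.2.2.1.trans hi.symm)⟩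
  rw [hBC, e1, e2, prod_count_prod_singleton, prod_count_prod_singleton,
    measure_action_image φ hinv]

lemma eq_smul_of_unique [MeasurableSpace X] {R : Set (X × X)} {μ ν : Measure X}
    [IsFiniteMeasure ν]
    (huniq : ∀ ν : Measure X, IsProbabilityMeasure ν → IsInvariantMeasure R ν → ν = μ)
    (hν : IsInvariantMeasure R ν) (h0 : ν Set.univ ≠ 0) : ν = ν Set.univ • μ := by
  have htop := measure_ne_top ν Set.univ
  rw [← huniq ((ν Set.univ)⁻¹ • ν) ⟨by simp [ENNReal.inv_mul_cancel h0 htop]⟩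
    fun h hh => by rw [Measure.map_smul, hν h hh], smul_smul, ENNReal.mul_inv_cancel h0 htop,
    one_smul]

/-- If a subgroup of `ℝ` contains the measures of all clopen subsets of a nonempty clopen set `W`,
then by minimality it contains the measures of all clopen sets. -/
lemma IsMinimalRel.clopen_measure_mem [CompactSpace X] [MeasurableSpace X] [BorelSpace X]
    (φ : G →* (X ≃ₜ X)) (hmin : IsMinimalRel (orbitRelOf φ)) {μ : Measure X} [IsFiniteMeasure μ]
    (hinv : IsInvariantMeasure (orbitRelOf φ) μ) {W : Set X} (hW : IsClopen W)
    (hne : W.Nonempty) (H : AddSubgroup ℝ)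
    (hH : ∀ V ⊆ W, IsClopen V → (μ V).toReal ∈ H) {V : Set X} (hV : IsClopen V) :
    (μ V).toReal ∈ H := by
  obtain ⟨t, ht⟩ := isCompact_univ.elim_finite_subcover (fun g => φ g ⁻¹' W)
    (fun g => hW.isOpen.preimage (φ g).continuous)
    fun x _ => Set.mem_iUnion.2 (hmin.exists_mem φ hW.isOpen hne x)
  have key : ∀ t : Finset G, ∀ V : Set X, IsClopen V → V ⊆ ⋃ g ∈ t, φ g ⁻¹' W →
      (μ V).toReal ∈ H := by
    classical
    intro t
    induction t using Finset.induction_on with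
    | empty =>
      intro V _ hVt
      have : V = ∅ := by simpa using hVt
      simp [this, H.zero_mem]
    | insert a s _ ih =>
      intro V hV hVt
      have hWa : IsClopen (φ a ⁻¹' W) := hW.preimage (φ a).continuous
      rw [← measure_inter_add_sdiff V hWa.isOpen.measurableSet,
        ENNReal.toReal_add (measure_ne_top _ _) (measure_ne_top _ _)]
      refine H.add_mem ?_ (ih _ (hV.diff hWa) ?_)
      · rw [← measure_action_image φ hinv a]
        refine hH _ ?_ ⟨(φ a).isClosedMap _ (hV.inter hWa).isClosed,
          (φ a).isOpenMap _ (hV.inter hWa).isOpen⟩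
        rintro _ ⟨x, hx, rfl⟩
        exact hx.2
      · rintro x ⟨hxV, hxa⟩
        have := hVt hxV
        rw [Finset.set_biUnion_insert] at this
        exact this.resolve_left hxa
  exact key t V hV ((Set.subset_univ V).trans ht)

end Helpers

/-- `F(R) ⊆ IM₊(E_μ)`, where `E_μ` is the additive subgroup of `ℝ` generated
by the measures of clopen sets. -/
theorem statement8 {G : Type*} [Group G] [Countable G] {X : Type*} [TopologicalSpace X] [CompactSpace X]
    [TopologicalSpace.MetrizableSpace X] [TotallyDisconnectedSpace X] [Nonempty X]
    [MeasurableSpace X] [BorelSpace X]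
    (hperf : Perfect (Set.univ : Set X))
    (φ : G →* (X ≃ₜ X)) (hfree : IsFreeAction φ) (hmin : IsMinimalRel (orbitRelOf φ))
    (μ : Measure X) [IsProbabilityMeasure μ] (hinv : IsInvariantMeasure (orbitRelOf φ) μ)
    (huniq : ∀ ν : Measure X, IsProbabilityMeasure ν → IsInvariantMeasure (orbitRelOf φ) ν → ν = μ) :
    fundGroup (orbitRelOf φ) μ ⊆ IMplus (clopenValueGroup μ) := by
  rintro l ⟨n, U, hU, ⟨F', hF'⟩, rfl⟩
  let _ := TopologicalSpace.metrizableSpaceMetric X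
  set m : Measure (X × Fin n) := μ.prod Measure.count with hm
  let F : X → X × Fin n := fun x => (F' x : X × Fin n)
  have hFce : Topology.IsClosedEmbedding F :=
    hU.isClosed.isClosedEmbedding_subtypeVal.comp F'.isClosedEmbedding
  have hFoe : Topology.IsOpenEmbedding F :=
    hU.isOpen.isOpenEmbedding_subtypeVal.comp F'.isOpenEmbedding
  have hFm : MeasurableEmbedding F := hFce.measurableEmbedding
  have hrange : Set.range F = U := by
    rw [← Subtype.range_coe (s := U)]
    exact F'.surjective.range_comp _
  have hνuniv : m.comap F Set.univ = m U := by
    rw [hFm.comap_apply, Set.image_univ, hrange]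
  have hνinv : IsInvariantMeasure (orbitRelOf φ) (m.comap F) :=
    isInvariantMeasure_comap φ hinv hFce.continuous hFm fun x y => (hF' x y).1
  have : IsFiniteMeasure (m.comap F) := ⟨hνuniv ▸ measure_lt_top m U⟩
  obtain ⟨x₀⟩ := ‹Nonempty X›
  set i₀ : Fin n := (F x₀).2
  set W : Set X := (fun x => (x, i₀)) ⁻¹' U with hWdef
  have hW : IsClopen W := hU.preimage (by fun_prop)
  have hWne : W.Nonempty := ⟨(F x₀).1, (F' x₀).2⟩
  have hsub : ∀ V ⊆ W, V ×ˢ {i₀} ⊆ U := by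
    rintro V hV ⟨a, i⟩ ⟨ha, hi⟩
    obtain rfl : i = i₀ := hi
    exact hV ha
  have hL0 : m U ≠ 0 := fun h => hmin.measure_ne_zero φ hinv hW.isOpen hWne <| by
    rw [← prod_count_prod_singleton μ W i₀]
    exact measure_mono_null (hsub W subset_rfl) h
  have hν : ∀ V, m (F '' V) = m U * μ V := fun V => by
    rw [← hFm.comap_apply, eq_smul_of_unique huniq hνinv (hνuniv ▸ hL0), hνuniv]
    simp
  set L : ℝ := (m U).toReal with hL
  have hLpos : 0 < L := ENNReal.toReal_pos hL0 (measure_ne_top _ _)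
  set E := clopenValueGroup μ with hE
  have hmul : ∀ x ∈ E, L * x ∈ E := by
    suffices h : E ≤ E.comap (AddMonoidHom.mulLeft L) from fun x hx => h hx
    refine (AddSubgroup.closure_le _).2 ?_
    rintro _ ⟨V, hV, rfl⟩
    change L * (μ V).toReal ∈ E
    rw [hL, ← ENNReal.toReal_mul, ← hν]
    exact prod_count_toReal_mem μ
      ⟨hFce.isClosedMap _ hV.isClosed, hFoe.isOpenMap _ hV.isOpen⟩
  have hdiv : ∀ x ∈ E, L⁻¹ * x ∈ E := by
    suffices h : E ≤ E.comap (AddMonoidHom.mulLeft L⁻¹) from fun x hx => h hx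
    refine (AddSubgroup.closure_le _).2 ?_
    rintro _ ⟨V, hV, rfl⟩
    refine hmin.clopen_measure_mem φ hinv hW hWne _ (fun V hVW hV => ?_) hV
    change L⁻¹ * (μ V).toReal ∈ E
    have hVU : F '' (F ⁻¹' (V ×ˢ {i₀})) = V ×ˢ {i₀} :=
      Set.image_preimage_eq_of_subset (hrange ▸ hsub V hVW)
    have hVm := hν (F ⁻¹' (V ×ˢ {i₀}))
    rw [hVU, prod_count_prod_singleton] at hVm
    rw [hVm, ENNReal.toReal_mul, inv_mul_cancel_left₀ hLpos.ne']
    exact AddSubgroup.subset_closure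
      ⟨_, (hV.prod (isClopen_discrete {i₀})).preimage hFce.continuous, rfl⟩
  have hone : (1 : ℝ) ∈ E := AddSubgroup.subset_closure ⟨Set.univ, isClopen_univ, by simp⟩
  refine ⟨hLpos, by simpa using hmul 1 hone, by simpa using hdiv 1 hone, ?_⟩
  refine Set.Subset.antisymm (Set.image_subset_iff.2 hmul) fun x hx => ?_
  exact ⟨L⁻¹ * x, hdiv x hx, mul_inv_cancel_left₀ hLpos.ne' x⟩
end
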